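/- For every pair of positive reals λ₁ < λ₂ there exists a random function (Markov kernel) κ̂ : ℕ → (probability distributions on ℕ) such that every distribution κ̂(i) is supported on {j ∈ ℕ : j ≤ 2(λ₂ − λ₁)}, and the total variation distance between Poisson(λ₂) and the law of P + K — where P is Poisson(λ₁) and, given P = i, K is drawn from κ̂(i) — is at most 1/2. -/

import Mathlib

/-- The Poisson probability mass function with parameter `lam`:
`Pr(P = k) = e^{−lam}·lam^k / k!`. -/
noncomputable def poissonP (lam : ℝ) (k : ℕ) : ℝ :=
  Real.exp (-lam) * lam ^ k / (Nat.factorial k : ℝ)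

theorem poissonP_nonneg {lam : ℝ} (h : 0 ≤ lam) (k : ℕ) : 0 ≤ poissonP lam k := by
  unfold poissonP
  positivity

theorem hasSum_poissonP {lam : ℝ} (h : 0 ≤ lam) : HasSum (poissonP lam) 1 :=
  ProbabilityTheory.hasSum_one_poissonMeasure ⟨lam, h⟩

theorem succ_mul_poissonP_succ (lam : ℝ) (k : ℕ) :
    ((k + 1 : ℕ) : ℝ) * poissonP lam (k + 1) = lam * poissonP lam k := by
  have h : (Nat.factorial k : ℝ) ≠ 0 := by positivity
  have h' : (k : ℝ) + 1 ≠ 0 := by positivity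
  simp only [poissonP, Nat.factorial_succ]
  push_cast
  field_simp
  ring

/-- The mean of the Poisson distribution. -/
theorem hasSum_mul_poissonP {lam : ℝ} (h : 0 ≤ lam) :
    HasSum (fun k : ℕ => (k : ℝ) * poissonP lam k) lam := by
  rw [← hasSum_nat_add_iff' 1]
  simpa [-Nat.cast_add, succ_mul_poissonP_succ] using (hasSum_poissonP h).mul_left lam

/-- Convolving two Poisson distributions adds their parameters. -/
theorem poissonP_add (a b : ℝ) (m : ℕ) :
    poissonP (a + b) m = ∑ i ∈ Finset.range (m + 1), poissonP a i * poissonP b (m - i) := by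
  simp only [poissonP]
  rw [add_pow, Finset.mul_sum, Finset.sum_div]
  refine Finset.sum_congr rfl fun i hi => ?_
  have him : i ≤ m := Nat.lt_succ_iff.mp (Finset.mem_range.mp hi)
  rw [Nat.cast_choose ℝ him, neg_add, Real.exp_add]
  have h1 : (Nat.factorial m : ℝ) ≠ 0 := by positivity
  have h2 : (Nat.factorial i : ℝ) ≠ 0 := by positivity
  have h3 : (Nat.factorial (m - i) : ℝ) ≠ 0 := by positivity
  field_simp

/-- The restriction of the Poisson mass function to the integers exceeding twice its mean. -/
noncomputable def poissonTail (lam : ℝ) (k : ℕ) : ℝ :=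
  if (k : ℝ) ≤ 2 * lam then 0 else poissonP lam k

theorem poissonTail_nonneg {lam : ℝ} (h : 0 ≤ lam) (k : ℕ) : 0 ≤ poissonTail lam k := by
  unfold poissonTail
  split_ifs
  exacts [le_rfl, poissonP_nonneg h k]

theorem poissonTail_le {lam : ℝ} (h : 0 ≤ lam) (k : ℕ) : poissonTail lam k ≤ poissonP lam k := by
  unfold poissonTail
  split_ifs
  exacts [poissonP_nonneg h k, le_rfl]

theorem summable_poissonTail {lam : ℝ} (h : 0 ≤ lam) : Summable (poissonTail lam) :=
  (hasSum_poissonP h).summable.of_nonneg_of_le (poissonTail_nonneg h) (poissonTail_le h)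

/-- Markov's inequality at twice the mean. -/
theorem tsum_poissonTail_le {lam : ℝ} (h : 0 < lam) : ∑' k, poissonTail lam k ≤ 1 / 2 := by
  have hs := (hasSum_mul_poissonP h.le).div_const (2 * lam)
  have hle : ∀ k : ℕ, poissonTail lam k ≤ (k : ℝ) * poissonP lam k / (2 * lam) := by
    intro k
    have hp := poissonP_nonneg h.le k
    unfold poissonTail
    split_ifs with hk
    · positivity
    · rw [le_div_iff₀ (by positivity), mul_comm]
      exact mul_le_mul_of_nonneg_right (not_le.mp hk).le hp
  calc ∑' k, poissonTail lam k ≤ lam / (2 * lam) :=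
        hasSum_le hle (summable_poissonTail h.le).hasSum hs
    _ = 1 / 2 := by field_simp

/-- **Corollary (bounded additive kernel approximating Poisson(λ₂)).** For all positive
`λ₁ < λ₂` there exists a Markov kernel `κ̂ : ℕ → (pmf on ℕ)` with every `κ̂ i` supported
on `{j : (j:ℝ) ≤ 2(λ₂ − λ₁)}`, such that the total variation distance between
`Poisson(λ₂)` and the law of `P + K` — where `P` is Poisson(λ₁) and, given `P = i`, `K`
is drawn from `κ̂ i` — is at most `1/2`. The law of `P + K` at `m` is
`Σ_{i ≤ m} Pr(P = i)·κ̂ i (m − i)`, and the TV distance is half the `ℓ¹` distance. -/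
theorem poisson_bounded_kernel_tv
    (lam₁ lam₂ : ℝ) (h₁ : 0 < lam₁) (h₁₂ : lam₁ < lam₂) :
    ∃ κ : ℕ → ℕ → ℝ,
      (∀ i j, 0 ≤ κ i j) ∧
      (∀ i, HasSum (κ i) 1) ∧
      (∀ i j, κ i j ≠ 0 → (j : ℝ) ≤ 2 * (lam₂ - lam₁)) ∧
      (1/2 : ℝ) * (∑' m : ℕ,
          |poissonP lam₂ m - ∑ i ∈ Finset.range (m + 1), poissonP lam₁ i * κ i (m - i)|)
        ≤ 1/2 := by
  obtain ⟨del, rfl⟩ : ∃ del, lam₂ = lam₁ + del := ⟨lam₂ - lam₁, by ring⟩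
  have hdel : 0 < del := by linarith
  rw [add_sub_cancel_left]
  set ε := ∑' k, poissonTail del k
  have hε0 : 0 ≤ ε := tsum_nonneg (poissonTail_nonneg hdel.le)
  have htail : HasSum (poissonTail del) ε := (summable_poissonTail hdel.le).hasSum
  have hatom : HasSum (fun j : ℕ => if j = 0 then ε else 0) ε := hasSum_ite_eq 0 ε
  have hatom0 : ∀ j : ℕ, 0 ≤ (if j = 0 then ε else 0) := fun j => by split_ifs <;> simp [hε0]
  refine ⟨fun _ j => poissonP del j - poissonTail del j + if j = 0 then ε else 0,
    fun _ j => add_nonneg (sub_nonneg.mpr (poissonTail_le hdel.le j)) (hatom0 j),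
    fun _ => by simpa using ((hasSum_poissonP hdel.le).sub htail).add hatom, ?_, ?_⟩
  · intro _ j hj
    contrapose! hj
    have hj0 : j ≠ 0 := by
      rintro rfl
      norm_num at hj
      linarith
    simp [poissonTail, hj.not_ge, hj0]
  · have hbound := htail.add hatom
    have hp := hasSum_poissonP h₁.le
    have hconv := hasSum_sum_range_mul_of_summable_norm hp.summable.norm hbound.summable.norm
    rw [hp.tsum_eq, hbound.tsum_eq, one_mul] at hconv
    have hle : ∀ m : ℕ, |poissonP (lam₁ + del) m - ∑ i ∈ Finset.range (m + 1), poissonP lam₁ i *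
        (poissonP del (m - i) - poissonTail del (m - i) + if m - i = 0 then ε else 0)| ≤
        ∑ i ∈ Finset.range (m + 1), poissonP lam₁ i *
          (poissonTail del (m - i) + if m - i = 0 then ε else 0) := by
      intro m
      rw [poissonP_add, ← Finset.sum_sub_distrib]
      refine (Finset.abs_sum_le_sum_abs _ _).trans (Finset.sum_le_sum fun i _ => ?_)
      rw [← mul_sub, abs_mul, abs_of_nonneg (poissonP_nonneg h₁.le i)]
      refine mul_le_mul_of_nonneg_left ?_ (poissonP_nonneg h₁.le i)
      have ht := poissonTail_nonneg hdel.le (m - i)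
      have ha := hatom0 (m - i)
      rw [abs_le]
      constructor <;> linarith
    have hsum := hconv.summable.of_nonneg_of_le (fun m => abs_nonneg _) hle
    have htv := hasSum_le hle hsum.hasSum hconv
    have hmarkov : ε ≤ 1 / 2 := tsum_poissonTail_le hdel
    linarith
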